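/- Let s ∈ X^n with n ≥ 2, let t, T > 0, and let ψ : X → [0,1]. Define μ = (1/n) Σ_{i∈[n]} ψ(s_i), μ_{-i} = (1/(n−1)) Σ_{j≠i} ψ(s_j), σ² = (1/n) Σ_{i∈[n]} (ψ(s_i) − μ)², and σ_{-i}² = (1/(n−1)) Σ_{j≠i} (ψ(s_j) − μ_{-i})². Then (1/n) Σ_{i∈[n]} D_KL( N(μ, max{σ²/t, 1/T}) ‖ N(μ_{-i}, max{σ_{-i}²/t, 1/T}) ) ≤ (1/(4n²)) · ( 2t + (T/t)·(1+ζ) ) · (1+ζ), where 1+ζ = (1 + 1/(n−1))² · ( 1 + (T/(tn))·(1 + 1/(n−1))² ). -/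

import Mathlib

open MeasureTheory ProbabilityTheory
open scoped BigOperators

/-- Kullback–Leibler divergence between two measures, as the integral of the
log-likelihood ratio. -/
noncomputable def klDiv {Ω : Type*} [MeasurableSpace Ω] (μ ν : Measure Ω) : ℝ :=
  ∫ x, llr μ ν x ∂μ

/-- Empirical mean `μ = (1/n) Σ_{i∈[n]} ψ(s_i)`. -/
noncomputable def empMean {X : Type*} {n : ℕ} (ψ : X → ℝ) (s : Fin n → X) : ℝ :=
  (∑ i : Fin n, ψ (s i)) / n

/-- Empirical variance `σ² = (1/n) Σ_{i∈[n]} (ψ(s_i) − μ)²`. -/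
noncomputable def empVar {X : Type*} {n : ℕ} (ψ : X → ℝ) (s : Fin n → X) : ℝ :=
  (∑ i : Fin n, (ψ (s i) - empMean ψ s) ^ 2) / n

/-- Leave-one-out mean `μ_{-i} = (1/(n−1)) Σ_{j≠i} ψ(s_j)`. -/
noncomputable def looMean {X : Type*} {n : ℕ} (ψ : X → ℝ) (s : Fin n → X) (i : Fin n) : ℝ :=
  (∑ j ∈ Finset.univ.erase i, ψ (s j)) / ((n : ℝ) - 1)

/-- Leave-one-out variance `σ_{-i}² = (1/(n−1)) Σ_{j≠i} (ψ(s_j) − μ_{-i})²`. -/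
noncomputable def looVar {X : Type*} {n : ℕ} (ψ : X → ℝ) (s : Fin n → X) (i : Fin n) : ℝ :=
  (∑ j ∈ Finset.univ.erase i, (ψ (s j) - looMean ψ s i) ^ 2) / ((n : ℝ) - 1)

lemma integral_sub_sq_gaussianReal (m a : ℝ) (v : NNReal) :
    Integrable (fun x ↦ (x - a) ^ 2) (gaussianReal m v) ∧
      ∫ x, (x - a) ^ 2 ∂gaussianReal m v = v + (m - a) ^ 2 := by
  have hid : MemLp (fun x : ℝ ↦ x) 2 (gaussianReal m v) := memLp_id_gaussianReal 2
  have hsub : MemLp (fun x : ℝ ↦ x - a) 2 (gaussianReal m v) := hid.sub (memLp_const a)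
  refine ⟨hsub.integrable_sq, ?_⟩
  have hvar : Var[fun x : ℝ ↦ x - a; gaussianReal m v] = v := by
    rw [variance_sub_const hid.aestronglyMeasurable, variance_fun_id_gaussianReal]
  have hmean : ∫ x, (x - a) ∂gaussianReal m v = m - a := by
    rw [integral_sub (hid.integrable one_le_two) (integrable_const a),
      integral_id_gaussianReal]
    simp
  rw [variance_eq_sub hsub, hmean] at hvar
  simp only [Pi.pow_apply] at hvar
  linarith

lemma llr_gaussianReal_ae_eq (m m' : ℝ) {v w : NNReal} (hv : v ≠ 0) (hw : w ≠ 0) :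
    llr (gaussianReal m v) (gaussianReal m' w) =ᵐ[gaussianReal m v]
      fun x ↦ Real.log (w / v) / 2 - (x - m) ^ 2 / (2 * v) + (x - m') ^ 2 / (2 * w) := by
  have hvol := gaussianReal_absolutelyContinuous m hv
  have hac : gaussianReal m v ≪ gaussianReal m' w :=
    hvol.trans (gaussianReal_absolutelyContinuous' m' hw)
  filter_upwards [hac.ae_le (Measure.rnDeriv_eq_div hvol
      (gaussianReal_absolutelyContinuous m' hw)),
    hvol.ae_le (rnDeriv_gaussianReal m v), hvol.ae_le (rnDeriv_gaussianReal m' w)]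
    with x hx hp hq
  have hv' : (0 : ℝ) < v := by positivity
  have hw' : (0 : ℝ) < w := by positivity
  have hπ := Real.pi_pos
  rw [llr, hx, hp, hq, ENNReal.toReal_div, toReal_gaussianPDF, toReal_gaussianPDF,
    Real.log_div (gaussianPDFReal_pos _ _ _ hv).ne' (gaussianPDFReal_pos _ _ _ hw).ne',
    gaussianPDFReal, gaussianPDFReal, Real.log_mul (by positivity) (by positivity),
    Real.log_mul (by positivity) (by positivity), Real.log_exp, Real.log_exp,
    Real.log_inv, Real.log_inv, Real.log_sqrt (by positivity), Real.log_sqrt (by positivity),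
    Real.log_mul (by positivity) hv'.ne', Real.log_mul (by positivity) hw'.ne',
    Real.log_div hw'.ne' hv'.ne']
  ring

lemma klDiv_gaussianReal (m m' : ℝ) {v w : NNReal} (hv : v ≠ 0) (hw : w ≠ 0) :
    klDiv (gaussianReal m v) (gaussianReal m' w) =
      (v / w - 1 - Real.log (v / w) + (m - m') ^ 2 / w) / 2 := by
  have hv' : (0 : ℝ) < v := by positivity
  have hw' : (0 : ℝ) < w := by positivity
  obtain ⟨h_int, hval⟩ := integral_sub_sq_gaussianReal m m v
  obtain ⟨h_int', hval'⟩ := integral_sub_sq_gaussianReal m m' v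
  have h_int_sub : Integrable (fun x ↦ Real.log (w / v) / 2 - (x - m) ^ 2 / (2 * v))
      (gaussianReal m v) := (integrable_const _).sub (h_int.div_const _)
  rw [klDiv, integral_congr_ae (llr_gaussianReal_ae_eq m m' hv hw),
    integral_add h_int_sub (h_int'.div_const _),
    integral_sub (integrable_const _) (h_int.div_const _), integral_div, integral_div,
    integral_div, hval, hval',
    Real.log_div hv'.ne' hw'.ne', Real.log_div hw'.ne' hv'.ne']
  simp
  field_simp
  ring

lemma sub_one_sub_log_le_of_one_le {r : ℝ} (hr : 1 ≤ r) :
    r - 1 - Real.log r ≤ (r - 1) ^ 2 / 2 := by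
  have h := Real.le_log_one_add_of_nonneg (x := r - 1) (by linarith)
  rw [add_sub_cancel, div_le_iff₀ (by linarith)] at h
  nlinarith [pow_nonneg (sub_nonneg.2 hr) 3]

lemma sub_one_sub_log_le_of_le_one {r : ℝ} (hr₀ : 0 < r) (hr : r ≤ 1) :
    r - 1 - Real.log r ≤ (r - 1) ^ 2 / (2 * r) := by
  have h := Real.sinh_le_self_iff.2 (Real.log_nonpos hr₀.le hr)
  rw [Real.sinh_log hr₀] at h
  have : (r - 1) ^ 2 / (2 * r) = r - 1 - (r - r⁻¹) / 2 := by
    field_simp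
    ring
  linarith

lemma div_sub_one_sub_log_div_le {v w u : ℝ} (hv : 0 < v) (hw : 0 < w)
    (hvu : 1 / v ≤ u) (hwu : 1 / w ≤ u) :
    v / w - 1 - Real.log (v / w) ≤ (v - w) ^ 2 * u ^ 2 / 2 := by
  have hv' : 0 < 1 / v := by positivity
  have hw' : 0 < 1 / w := by positivity
  have hsq : (1 / w) ^ 2 ≤ u ^ 2 := by gcongr
  have hmul : 1 / v * (1 / w) ≤ u ^ 2 := by
    rw [sq]
    gcongr
    linarith
  rcases le_total w v with h | h
  · refine (sub_one_sub_log_le_of_one_le ((one_le_div hw).2 h)).trans ?_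
    calc (v / w - 1) ^ 2 / 2 = (v - w) ^ 2 * (1 / w) ^ 2 / 2 := by field_simp
      _ ≤ _ := by gcongr
  · refine (sub_one_sub_log_le_of_le_one (by positivity) ((div_le_one hw).2 h)).trans ?_
    calc (v / w - 1) ^ 2 / (2 * (v / w)) = (v - w) ^ 2 * (1 / v * (1 / w)) / 2 := by field_simp
      _ ≤ _ := by gcongr

section EmpiricalMoments

variable {X : Type*} {n : ℕ} (ψ : X → ℝ) (s : Fin n → X)

lemma empVar_nonneg : 0 ≤ empVar ψ s := by
  unfold empVar
  positivity

lemma empMean_sub_looMean (hn : 2 ≤ n) (i : Fin n) :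
    empMean ψ s - looMean ψ s i = (ψ (s i) - empMean ψ s) / ((n : ℝ) - 1) := by
  have hn' : (2 : ℝ) ≤ n := by exact_mod_cast hn
  have h₀ : (n : ℝ) ≠ 0 := by positivity
  have h₁ : (n : ℝ) - 1 ≠ 0 := by linarith
  rw [looMean, Finset.sum_erase_eq_sub (Finset.mem_univ i), empMean]
  field_simp
  ring

lemma empVar_sub_looVar (hn : 2 ≤ n) (i : Fin n) :
    empVar ψ s - looVar ψ s i = ((n : ℝ) / (n - 1)) ^ 2 / n *
      ((ψ (s i) - empMean ψ s) ^ 2 - empVar ψ s * ((n - 1) / n)) := by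
  have hn' : (2 : ℝ) ≤ n := by exact_mod_cast hn
  have h₀ : (n : ℝ) ≠ 0 := by positivity
  have h₁ : (n : ℝ) - 1 ≠ 0 := by linarith
  have hsum (a : ℝ) : ∑ j, (ψ (s j) - a) ^ 2 =
      ∑ j, ψ (s j) ^ 2 - 2 * a * ∑ j, ψ (s j) + n * a ^ 2 := by
    simp only [sub_sq, Finset.sum_add_distrib, Finset.sum_sub_distrib, Finset.mul_sum]
    simp [mul_left_comm, mul_comm]
  rw [looVar, Finset.sum_erase_eq_sub (Finset.mem_univ i), empVar, hsum, hsum, looMean,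
    Finset.sum_erase_eq_sub (Finset.mem_univ i), empMean]
  field_simp
  ring

variable {ψ}

lemma sq_sub_empMean_le_one (hψ : ∀ x, ψ x ∈ Set.Icc (0 : ℝ) 1) (i : Fin n) :
    (ψ (s i) - empMean ψ s) ^ 2 ≤ 1 := by
  have hn : (0 : ℝ) < n := by exact_mod_cast i.pos
  have h₀ : 0 ≤ empMean ψ s :=
    div_nonneg (Finset.sum_nonneg fun j _ ↦ (hψ (s j)).1) hn.le
  have h₁ : empMean ψ s ≤ 1 := by
    rw [empMean, div_le_one hn]
    simpa using Finset.sum_le_sum fun j (_ : j ∈ Finset.univ) ↦ (hψ (s j)).2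
  obtain ⟨h₂, h₃⟩ := hψ (s i)
  rw [sq_le_one_iff_abs_le_one, abs_le]
  constructor <;> linarith

lemma sum_sq_sub_le_sum {ι : Type*} (I : Finset ι) (f : ι → ℝ) {m b : ℝ}
    (hf : ∀ i ∈ I, f i ∈ Set.Icc (0 : ℝ) 1) (hm : I.card * m = ∑ i ∈ I, f i)
    (hb₀ : 0 ≤ b) (hb : b ≤ 1) :
    ∑ i ∈ I, (f i - m * b) ^ 2 ≤ ∑ i ∈ I, f i := by
  have hsum : ∑ i ∈ I, (f i - m * b) ^ 2 =
      ∑ i ∈ I, f i ^ 2 - 2 * (m * b) * ∑ i ∈ I, f i + I.card * (m * b) ^ 2 := by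
    simp only [sub_sq, Finset.sum_add_distrib, Finset.sum_sub_distrib, Finset.mul_sum]
    simp [mul_assoc, mul_left_comm, mul_comm]
  have hsq : ∑ i ∈ I, f i ^ 2 ≤ ∑ i ∈ I, f i :=
    Finset.sum_le_sum fun i hi ↦ by nlinarith [(hf i hi).1, (hf i hi).2]
  have h : 0 ≤ (I.card * m ^ 2) * (b * (2 - b)) :=
    mul_nonneg (by positivity) (mul_nonneg hb₀ (by linarith))
  rw [hsum, ← hm]
  rw [← hm] at hsq
  nlinarith

end EmpiricalMoments

lemma max_div_le_mul_max_div {V V' t T δ : ℝ} (ht : 0 < t) (hT : 0 < T) (hδ : 0 ≤ δ)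
    (h : V - V' ≤ δ) :
    max (V / t) (1 / T) ≤ (1 + T * δ / t) * max (V' / t) (1 / T) := by
  have h₁ : V' / t ≤ max (V' / t) (1 / T) := le_max_left _ _
  have h₂ : 1 / T ≤ max (V' / t) (1 / T) := le_max_right _ _
  have h₃ : δ / t ≤ T * δ / t * max (V' / t) (1 / T) :=
    calc δ / t = T * δ / t * (1 / T) := by field_simp
      _ ≤ _ := by gcongr
  have h₄ : V / t ≤ V' / t + δ / t := by
    rw [← add_div]
    gcongr
    linarith
  have h₅ : 0 ≤ δ / t := by positivity
  refine max_le ?_ ?_ <;> linarith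

lemma klDiv_gaussianReal_max_le {m m' V V' t T δ : ℝ} (ht : 0 < t) (hT : 0 < T) (hδ : 0 ≤ δ)
    (h : V - V' ≤ δ) :
    klDiv (gaussianReal m (max (V / t) (1 / T)).toNNReal)
        (gaussianReal m' (max (V' / t) (1 / T)).toNNReal) ≤
      ((V - V') ^ 2 * ((1 + T * δ / t) / max (V / t) (1 / T)) ^ 2 / (2 * t ^ 2) +
        (m - m') ^ 2 * ((1 + T * δ / t) / max (V / t) (1 / T))) / 2 := by
  have hle := max_div_le_mul_max_div ht hT hδ h
  have hdiff := abs_max_sub_max_le_abs (V / t) (V' / t) (1 / T)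
  have hv : 0 < max (V / t) (1 / T) := lt_max_of_lt_right (by positivity)
  have hw : 0 < max (V' / t) (1 / T) := lt_max_of_lt_right (by positivity)
  rw [klDiv_gaussianReal _ _ (Real.toNNReal_pos.2 hv).ne' (Real.toNNReal_pos.2 hw).ne',
    Real.coe_toNNReal _ hv.le, Real.coe_toNNReal _ hw.le]
  set v := max (V / t) (1 / T)
  set w := max (V' / t) (1 / T)
  set a := 1 + T * δ / t with ha
  have ha₁ : 1 ≤ a := le_add_of_nonneg_right (by positivity)
  have hvu : 1 / v ≤ a / v := by gcongr
  have hwu : 1 / w ≤ a / v := by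
    rw [div_le_div_iff₀ hw hv]
    linarith
  have hsq : (v - w) ^ 2 ≤ (V - V') ^ 2 / t ^ 2 := by
    rw [← div_pow, sub_div]
    exact sq_le_sq.2 hdiff
  have hlog := div_sub_one_sub_log_div_le hv hw hvu hwu
  have hvar : (v - w) ^ 2 * (a / v) ^ 2 / 2 ≤ (V - V') ^ 2 / t ^ 2 * (a / v) ^ 2 / 2 := by
    gcongr
  have hmean : (m - m') ^ 2 / w ≤ (m - m') ^ 2 * (a / v) := by
    rw [div_eq_mul_one_div]
    gcongr
  have heq : (V - V') ^ 2 / t ^ 2 * (a / v) ^ 2 / 2 =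
      (V - V') ^ 2 * (a / v) ^ 2 / (2 * t ^ 2) := by field_simp
  linarith

/-- **ALKL stability of variance-calibrated Gaussian noise (Proposition 4.2).**
For a dataset `s ∈ X^n` with `n ≥ 2`, parameters `t, T > 0`, and a query `ψ : X → [0,1]`,
the average over `i ∈ [n]` of the KL divergence from `N(μ_{-i}, max{σ_{-i}²/t, 1/T})` to
`N(μ, max{σ²/t, 1/T})` is at most `(1/(4n²))·(2t + (T/t)(1+ζ))·(1+ζ)` where
`1+ζ = (1 + 1/(n−1))²·(1 + (T/(tn))·(1 + 1/(n−1))²)`. -/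
theorem variance_calibrated_gaussian_alkl {X : Type*} {n : ℕ} (hn : 2 ≤ n)
    (s : Fin n → X) (t T : ℝ) (ht : 0 < t) (hT : 0 < T)
    (ψ : X → ℝ) (hψ : ∀ x, ψ x ∈ Set.Icc (0 : ℝ) 1)
    (ζ : ℝ)
    (hζ : 1 + ζ =
      (1 + 1 / ((n : ℝ) - 1)) ^ 2 * (1 + T / (t * n) * (1 + 1 / ((n : ℝ) - 1)) ^ 2)) :
    (1 / (n : ℝ)) * ∑ i : Fin n,
        klDiv (gaussianReal (empMean ψ s) (max (empVar ψ s / t) (1 / T)).toNNReal)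
          (gaussianReal (looMean ψ s i) (max (looVar ψ s i / t) (1 / T)).toNNReal) ≤
      1 / (4 * (n : ℝ) ^ 2) * (2 * t + T / t * (1 + ζ)) * (1 + ζ) := by
  have hn' : (2 : ℝ) ≤ n := by exact_mod_cast hn
  have hN : (0 : ℝ) < n := by positivity
  have hN₁ : (0 : ℝ) < n - 1 := by linarith
  set N : ℝ := (n : ℝ)
  set V := empVar ψ s with hV_def
  have hV : 0 ≤ V := empVar_nonneg ψ s
  set d : Fin n → ℝ := fun i ↦ (ψ (s i) - empMean ψ s) ^ 2
  have hsum_d : N * V = ∑ i, d i := by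
    simp only [hV_def, empVar, d]
    exact mul_div_cancel₀ _ hN.ne'
  set c := N / (N - 1) with hc
  set δ := c ^ 2 / N with hδ_def
  have hδ : 0 ≤ δ := by positivity
  have hVsub (i : Fin n) : V - looVar ψ s i = δ * (d i - V * ((N - 1) / N)) :=
    empVar_sub_looVar ψ s hn i
  have hd₁ (i : Fin n) : d i ≤ 1 := sq_sub_empMean_le_one s hψ i
  have hVle (i : Fin n) : V - looVar ψ s i ≤ δ := by
    rw [hVsub]
    have : 0 ≤ V * ((N - 1) / N) := by positivity
    exact mul_le_of_le_one_right hδ (by linarith [hd₁ i])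
  set v := max (V / t) (1 / T)
  have hv : 0 < v := lt_max_of_lt_right (by positivity)
  set a := 1 + T * δ / t with ha
  have ha₀ : 0 < a := by positivity
  have hterm (i : Fin n) :
      klDiv (gaussianReal (empMean ψ s) v.toNNReal)
          (gaussianReal (looMean ψ s i) (max (looVar ψ s i / t) (1 / T)).toNNReal) ≤
        (d i - V * ((N - 1) / N)) ^ 2 * (δ ^ 2 * (a / v) ^ 2 / (4 * t ^ 2)) +
          d i * (a / v / (2 * (N - 1) ^ 2)) := by
    refine (klDiv_gaussianReal_max_le ht hT hδ (hVle i)).trans_eq ?_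
    rw [hVsub, empMean_sub_looMean ψ s hn, div_pow (ψ (s i) - empMean ψ s)]
    change ((δ * (d i - V * ((N - 1) / N))) ^ 2 * (a / v) ^ 2 / (2 * t ^ 2) +
      d i / (N - 1) ^ 2 * (a / v)) / 2 = _
    field_simp
    ring
  have hvar : ∑ i, (d i - V * ((N - 1) / N)) ^ 2 ≤ N * V := by
    rw [hsum_d]
    refine sum_sq_sub_le_sum _ _ (fun i _ ↦ ⟨sq_nonneg _, hd₁ i⟩) (by simpa using hsum_d)
      (by positivity) ((div_le_one hN).2 (by linarith))
  have hVv : V / v ≤ t := by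
    rw [div_le_iff₀ hv, mul_comm, ← div_le_iff₀ ht]
    exact le_max_left _ _
  have hTv : 1 / v ≤ T := by
    rw [one_div_le hv hT]
    exact le_max_right _ _
  have hA : 1 + ζ = c ^ 2 * a := by
    rw [hζ, ha, hδ_def, hc]
    field_simp
    ring
  calc 1 / N * ∑ i, klDiv (gaussianReal (empMean ψ s) v.toNNReal)
          (gaussianReal (looMean ψ s i) (max (looVar ψ s i / t) (1 / T)).toNNReal)
      ≤ 1 / N * ∑ i, ((d i - V * ((N - 1) / N)) ^ 2 * (δ ^ 2 * (a / v) ^ 2 / (4 * t ^ 2)) +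
          d i * (a / v / (2 * (N - 1) ^ 2))) := by
        gcongr with i
        exact hterm i
    _ ≤ 1 / N * (N * V * (δ ^ 2 * (a / v) ^ 2 / (4 * t ^ 2)) +
          N * V * (a / v / (2 * (N - 1) ^ 2))) := by
        rw [Finset.sum_add_distrib, ← Finset.sum_mul, ← Finset.sum_mul, ← hsum_d]
        gcongr
    _ = δ ^ 2 * a ^ 2 / (4 * t ^ 2) * (V / v * (1 / v)) +
          a / (2 * (N - 1) ^ 2) * (V / v) := by
        field_simp
    _ ≤ δ ^ 2 * a ^ 2 / (4 * t ^ 2) * (t * T) + a / (2 * (N - 1) ^ 2) * t := by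
        gcongr
    _ = 1 / (4 * N ^ 2) * (2 * t + T / t * (1 + ζ)) * (1 + ζ) := by
        rw [hA, hδ_def, hc]
        field_simp
        ring
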